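/- arXiv:2203.11561 — 3 statements merged into one kernel-verified Lean document; each statement's English description precedes it below -/
import Mathlib

section
/- Let Φ be the FJLT as in the context and let x, y ∈ ℝ^d be fixed. Then for every row index i ∈ {1,…,k}, E[(Φx)_i²·(Φy)_i²] = (3/d)·(d/3 + (1/q − 1))·(‖x‖₂²·‖y‖₂² + 2·⟨x,y⟩²) − (6/d)·(1/q − 1)·Σ_{j=1}^d x_j²·y_j²; and for all distinct row indices i ≠ n, E[(Φx)_i²·(Φy)_n²] = ‖x‖₂²·‖y‖₂². -/
open MeasureTheory ProbabilityTheory Finset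
open scoped ENNReal NNReal

/-- Uniform distribution on `{-1, +1} ⊆ ℝ` (law of a Rademacher sign). -/
noncomputable def signMeasure : Measure ℝ :=
  ((2 : ℝ≥0)⁻¹) • Measure.dirac (-1) + ((2 : ℝ≥0)⁻¹) • Measure.dirac 1

instance : IsFiniteMeasure signMeasure := by unfold signMeasure; infer_instance

/-- Distribution of an entry of the FJLT matrix `P`: a sample of `N(0, 1/q)` with
probability `q` and `0` with probability `1 - q`. -/
noncomputable def fjltEntryMeasure (q : ℝ) : Measure ℝ :=
  q.toNNReal • gaussianReal 0 q.toNNReal⁻¹ + (1 - q).toNNReal • Measure.dirac 0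

instance (q : ℝ) : IsFiniteMeasure (fjltEntryMeasure q) := by
  unfold fjltEntryMeasure; infer_instance

/-- The normalized `2^m × 2^m` Hadamard matrix: `H f j = d^{-1/2} * (-1)^{⟨f, j⟩}`,
where `⟨f, j⟩` is the inner product of the binary expansions of `f` and `j`. -/
noncomputable def hadamardMat (m : ℕ) (f j : Fin (2 ^ m)) : ℝ :=
  (-1 : ℝ) ^ (∑ b ∈ Finset.range m, if f.val.testBit b && j.val.testBit b then 1 else 0) /
    Real.sqrt (2 ^ m)

/-- The `(i, j)` entry of the FJLT matrix `Φ = P·H·D`, given the realizations of the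
sparse Gaussian matrix `P` and the diagonal sign vector `D`. -/
noncomputable def fjltEntry {m k : ℕ} (P : (Fin k × Fin (2 ^ m)) → ℝ)
    (D : Fin (2 ^ m) → ℝ) (i : Fin k) (j : Fin (2 ^ m)) : ℝ :=
  ∑ f, P (i, f) * hadamardMat m f j * D j

/-- If `M n` is the `n`-th moment of centred i.i.d. variables `z p` with unit variance and vanishing
third moment, the left side is the expectation of `z i * z j * z k * z l`. -/
lemma prod_moment_count {ι : Type*} [Fintype ι] [DecidableEq ι] {M : ℕ → ℝ}
    (h0 : M 0 = 1) (h1 : M 1 = 0) (h2 : M 2 = 1) (h3 : M 3 = 0) (i j k l : ι) :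
    ∏ p, M ((if p = i then 1 else 0) + (if p = j then 1 else 0) + (if p = k then 1 else 0)
        + (if p = l then 1 else 0))
      = (if i = j then if k = l then 1 else 0 else 0)
        + (if i = k then if j = l then 1 else 0 else 0)
        + (if i = l then if j = k then 1 else 0 else 0)
        + (M 4 - 3) * (if i = j then if i = k then if i = l then 1 else 0 else 0 else 0) := by
  by_cases hall : i = j ∧ i = k ∧ i = l
  · obtain ⟨rfl, rfl, rfl⟩ := hall
    rw [Finset.prod_eq_single i]
    · norm_num
    · intro p _ hp
      simp [hp, h0]
    · simp
  by_cases hpair : (i = j ∧ k = l) ∨ (i = k ∧ j = l) ∨ (i = l ∧ j = k)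
  · rw [Finset.prod_eq_one]
    · grind
    · intro p _
      grind
  · have hodd : ∃ p : ι, M ((if p = i then 1 else 0) + (if p = j then 1 else 0)
        + (if p = k then 1 else 0) + (if p = l then 1 else 0)) = 0 := by
      by_cases hij : i = j
      · exact ⟨k, by grind⟩
      by_cases hik : i = k
      · exact ⟨j, by grind⟩
      by_cases hil : i = l
      · exact ⟨j, by grind⟩
      · exact ⟨i, by grind⟩
    obtain ⟨p, hp⟩ := hodd
    rw [Finset.prod_eq_zero (mem_univ p) hp]
    grind

lemma sq_sum_mul_sq_sum_expand {ι : Type*} [Fintype ι] (a b z : ι → ℝ) :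
    (∑ i, a i * z i) ^ 2 * (∑ i, b i * z i) ^ 2
      = ∑ i, ∑ j, ∑ k, ∑ l, a i * a j * b k * b l * (z i * z j * z k * z l) := by
  simp_rw [pow_two, Finset.sum_mul_sum]
  refine sum_congr rfl fun i _ => ?_
  rw [sum_comm]
  refine sum_congr rfl fun j _ => sum_congr rfl fun k _ => sum_congr rfl fun l _ => by ring

lemma mul_four_eq_prod_pow {ι : Type*} [Fintype ι] [DecidableEq ι] (z : ι → ℝ) (i j k l : ι) :
    z i * z j * z k * z l
      = ∏ p, z p ^ ((if p = i then 1 else 0) + (if p = j then 1 else 0)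
          + (if p = k then 1 else 0) + (if p = l then 1 else 0)) := by
  simp only [pow_add, Finset.prod_mul_distrib]
  simp [pow_ite]

lemma integrable_sq_sum_mul_sq_sum {ι : Type*} [Fintype ι] {μ : Measure ℝ} [IsFiniteMeasure μ]
    (hint : ∀ n : ℕ, Integrable (fun t : ℝ => t ^ n) μ) (a b : ι → ℝ) :
    Integrable (fun z : ι → ℝ => (∑ i, a i * z i) ^ 2 * (∑ i, b i * z i) ^ 2)
      (Measure.pi fun _ => μ) := by
  classical
  simp_rw [sq_sum_mul_sq_sum_expand, mul_four_eq_prod_pow]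
  refine integrable_finsetSum _ fun i _ => integrable_finsetSum _ fun j _ =>
    integrable_finsetSum _ fun k _ => integrable_finsetSum _ fun l _ => Integrable.const_mul ?_ _
  exact Integrable.fintype_prod (μ := fun _ : ι => μ) fun p => hint _

/-- The mixed fourth moment of two linear forms in i.i.d. variables with vanishing first and third
moments and unit variance. -/
lemma integral_sq_sum_mul_sq_sum {ι : Type*} [Fintype ι] {μ : Measure ℝ} [IsFiniteMeasure μ]
    (hint : ∀ n : ℕ, Integrable (fun t : ℝ => t ^ n) μ)
    (h0 : ∫ t, t ^ 0 ∂μ = 1) (h1 : ∫ t, t ^ 1 ∂μ = 0) (h2 : ∫ t, t ^ 2 ∂μ = 1)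
    (h3 : ∫ t, t ^ 3 ∂μ = 0) (a b : ι → ℝ) :
    ∫ z : ι → ℝ, (∑ i, a i * z i) ^ 2 * (∑ i, b i * z i) ^ 2 ∂(Measure.pi fun _ => μ)
      = (∑ i, a i ^ 2) * (∑ i, b i ^ 2) + 2 * (∑ i, a i * b i) ^ 2
        + (∫ t, t ^ 4 ∂μ - 3) * ∑ i, a i ^ 2 * b i ^ 2 := by
  classical
  have hterm : ∀ i j k l : ι, Integrable (fun z : ι → ℝ =>
      a i * a j * b k * b l * ∏ p, z p ^ ((if p = i then 1 else 0) + (if p = j then 1 else 0)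
          + (if p = k then 1 else 0) + (if p = l then 1 else 0))) (Measure.pi fun _ => μ) :=
    fun i j k l => Integrable.const_mul
      (Integrable.fintype_prod (μ := fun _ : ι => μ) fun p => hint _) _
  have hval : ∀ i j k l : ι, ∫ z : ι → ℝ,
      a i * a j * b k * b l * ∏ p, z p ^ ((if p = i then 1 else 0) + (if p = j then 1 else 0)
          + (if p = k then 1 else 0) + (if p = l then 1 else 0)) ∂(Measure.pi fun _ => μ)
      = a i * a j * b k * b l * ((if i = j then if k = l then 1 else 0 else 0)
        + (if i = k then if j = l then 1 else 0 else 0)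
        + (if i = l then if j = k then 1 else 0 else 0)
        + (∫ t, t ^ 4 ∂μ - 3) *
          (if i = j then if i = k then if i = l then 1 else 0 else 0 else 0)) := by
    intro i j k l
    rw [integral_const_mul, integral_fintype_prod_eq_prod (μ := fun _ : ι => μ)
      (f := fun p (t : ℝ) => t ^ ((if p = i then 1 else 0) + (if p = j then 1 else 0)
          + (if p = k then 1 else 0) + (if p = l then 1 else 0)))]
    rw [prod_moment_count (M := fun n => ∫ t, t ^ n ∂μ) h0 h1 h2 h3]
  simp_rw [sq_sum_mul_sq_sum_expand, mul_four_eq_prod_pow]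
  rw [integral_finsetSum _ fun i _ => integrable_finsetSum _ fun j _ =>
    integrable_finsetSum _ fun k _ => integrable_finsetSum _ fun l _ => hterm i j k l]
  simp_rw [integral_finsetSum _ fun j _ => integrable_finsetSum _ fun k _ =>
    integrable_finsetSum _ fun l _ => hterm _ j k l,
    integral_finsetSum _ fun k _ => integrable_finsetSum _ fun l _ => hterm _ _ k l,
    integral_finsetSum _ fun l _ => hterm _ _ _ l, hval]
  simp only [mul_add, mul_ite, mul_one, mul_zero, sum_add_distrib, Finset.sum_ite_eq,
    Finset.sum_ite_irrel, Finset.sum_const_zero, mem_univ, if_true]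
  simp_rw [pow_two, Finset.sum_mul_sum, Finset.mul_sum, two_mul]
  simp_rw [sum_add_distrib, ← add_assoc]
  refine congr_arg₂ _ (congr_arg₂ _ (congr_arg₂ _ ?_ ?_) ?_) ?_
  all_goals
    refine sum_congr rfl fun i _ => ?_
    try refine sum_congr rfl fun j _ => ?_
    ring

lemma integrable_pow_signMeasure (n : ℕ) : Integrable (fun t : ℝ => t ^ n) signMeasure := by
  unfold signMeasure
  refine Integrable.add_measure ?_ ?_ <;>
    exact (integrable_dirac (by simp)).smul_measure_nnreal

lemma integral_pow_signMeasure (n : ℕ) :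
    ∫ t, t ^ n ∂signMeasure = ((-1) ^ n + 1) / 2 := by
  unfold signMeasure
  rw [integral_add_measure, integral_smul_nnreal_measure, integral_smul_nnreal_measure,
    integral_dirac, integral_dirac]
  · simp [NNReal.smul_def]
    ring
  all_goals exact (integrable_dirac (by simp)).smul_measure_nnreal

lemma ae_sq_eq_one_signMeasure : ∀ᵐ t ∂signMeasure, t ^ 2 = 1 := by
  unfold signMeasure
  have hs : MeasurableSet {t : ℝ | t ^ 2 = 1} := measurableSet_eq_fun (by fun_prop) (by fun_prop)
  rw [ae_add_measure_iff]
  constructor <;> refine Measure.ae_smul_measure ?_ _ <;> rw [ae_dirac_iff hs] <;> norm_num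

lemma integrable_pow_gaussianReal (μ : ℝ) (v : ℝ≥0) (n : ℕ) :
    Integrable (fun t : ℝ => t ^ n) (gaussianReal μ v) := by
  have h := memLp_id_gaussianReal (μ := μ) (v := v) (n : ℝ≥0)
  refine (integrable_norm_iff (by fun_prop)).1 ?_
  have hpow := MemLp.integrable_norm_pow' (p := n) (by simpa using h)
  simpa only [id, norm_pow] using hpow

/-- The first four moments of a centred Gaussian. -/
lemma integral_pow_gaussianReal (v : ℝ≥0) :
    ∫ t, t ^ 1 ∂(gaussianReal 0 v) = 0 ∧ ∫ t, t ^ 2 ∂(gaussianReal 0 v) = v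
      ∧ ∫ t, t ^ 3 ∂(gaussianReal 0 v) = 0 ∧ ∫ t, t ^ 4 ∂(gaussianReal 0 v) = 3 * (v : ℝ) ^ 2 := by
  have hmom : ∀ n : ℕ, ∫ t, t ^ n ∂(gaussianReal 0 v)
      = iteratedDeriv n (fun t : ℝ => Real.exp (v * t ^ 2 / 2)) 0 := by
    intro n
    have h := iteratedDeriv_mgf_zero (X := id) (μ := gaussianReal 0 v) (by simp) n
    rw [mgf_id_gaussianReal] at h
    simpa using h.symm
  have hexp : ∀ t : ℝ, HasDerivAt (fun t : ℝ => Real.exp (v * t ^ 2 / 2))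
      (Real.exp (v * t ^ 2 / 2) * (v * t)) t := by
    intro t
    refine ((((hasDerivAt_id' t).fun_pow 2).const_mul (v : ℝ)).div_const 2).exp.congr_deriv ?_
    norm_num
    ring
  have hmul : ∀ (p p' : ℝ → ℝ), (∀ t, HasDerivAt p (p' t) t) →
      deriv (fun t : ℝ => p t * Real.exp (v * t ^ 2 / 2))
        = fun t => (p' t + v * t * p t) * Real.exp (v * t ^ 2 / 2) := by
    intro p p' hp
    funext t
    rw [((hp t).fun_mul (hexp t)).deriv]
    ring
  have d1 : deriv (fun t : ℝ => Real.exp (v * t ^ 2 / 2))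
      = fun t => (v * t) * Real.exp (v * t ^ 2 / 2) := by
    funext t
    rw [(hexp t).deriv, mul_comm]
  have d2 := hmul (fun t => v * t) (fun _ => v) fun t => by
    simpa using (hasDerivAt_id t).const_mul (v : ℝ)
  have d3 := hmul (fun t => v + v * t * (v * t)) (fun t => 2 * v ^ 2 * t) fun t => by
    have h := (hasDerivAt_id' t).const_mul (v : ℝ)
    refine ((h.fun_mul h).const_add (v : ℝ)).congr_deriv ?_
    ring
  have d4 := hmul (fun t => 2 * v ^ 2 * t + v * t * (v + v * t * (v * t)))
    (fun t => 3 * v ^ 2 + 3 * v ^ 3 * t ^ 2) fun t => by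
    have h := (hasDerivAt_id' t).const_mul (v : ℝ)
    refine (((hasDerivAt_id' t).const_mul (2 * (v : ℝ) ^ 2)).fun_add
      (h.fun_mul ((h.fun_mul h).const_add (v : ℝ)))).congr_deriv ?_
    ring
  refine ⟨?_, ?_, ?_, ?_⟩ <;> rw [hmom] <;>
    simp [iteratedDeriv_succ, iteratedDeriv_zero, d1, d2, d3, d4]

lemma integrable_pow_fjltEntryMeasure (q : ℝ) (n : ℕ) :
    Integrable (fun t : ℝ => t ^ n) (fjltEntryMeasure q) := by
  unfold fjltEntryMeasure
  exact Integrable.add_measure (integrable_pow_gaussianReal _ _ _).smul_measure_nnreal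
    (integrable_dirac (by simp)).smul_measure_nnreal

lemma integral_pow_fjltEntryMeasure {q : ℝ} (hq0 : 0 < q) (hq1 : q ≤ 1) (n : ℕ) :
    ∫ t, t ^ n ∂(fjltEntryMeasure q)
      = q * ∫ t, t ^ n ∂(gaussianReal 0 q.toNNReal⁻¹) + (1 - q) * 0 ^ n := by
  unfold fjltEntryMeasure
  rw [integral_add_measure (integrable_pow_gaussianReal _ _ _).smul_measure_nnreal
    (integrable_dirac (by simp)).smul_measure_nnreal, integral_smul_nnreal_measure,
    integral_smul_nnreal_measure, integral_dirac]
  simp [NNReal.smul_def, hq0.le, hq1]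

/-- The sign of a Hadamard entry as a product over bits. -/
lemma hadamardMat_eq_prod (m : ℕ) (f j : Fin (2 ^ m)) :
    hadamardMat m f j
      = (∏ b ∈ range m, if f.val.testBit b && j.val.testBit b then (-1 : ℝ) else 1)
        / Real.sqrt (2 ^ m) := by
  unfold hadamardMat
  rw [← Finset.prod_pow_eq_pow_sum]
  congr 1
  refine prod_congr rfl fun b _ => ?_
  split_ifs <;> simp

lemma hadamardMat_sq (m : ℕ) (f j : Fin (2 ^ m)) : hadamardMat m f j ^ 2 = 1 / 2 ^ m := by
  unfold hadamardMat
  rw [div_pow, Real.sq_sqrt (by positivity), ← pow_mul, mul_comm, pow_mul]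
  simp

/-- Distinct columns are orthogonal: flipping a bit of the row index in which the two column indices
differ negates the summand. -/
lemma sum_hadamardMat_mul_of_ne (m : ℕ) {j j' : Fin (2 ^ m)} (hne : j ≠ j') :
    ∑ f, hadamardMat m f j * hadamardMat m f j' = 0 := by
  obtain ⟨b, hb⟩ : ∃ b, j.val.testBit b ≠ j'.val.testBit b := by
    by_contra! h
    exact hne (Fin.ext (Nat.eq_of_testBit_eq h))
  have hbm : b < m := by
    by_contra! h
    have hpow : 2 ^ m ≤ 2 ^ b := Nat.pow_le_pow_right (by norm_num) h
    rw [Nat.testBit_lt_two_pow (j.isLt.trans_le hpow),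
      Nat.testBit_lt_two_pow (j'.isLt.trans_le hpow)] at hb
    exact hb rfl
  let flip : Fin (2 ^ m) → Fin (2 ^ m) := fun f =>
    ⟨f.val ^^^ 2 ^ b, Nat.xor_lt_two_pow f.isLt (Nat.pow_lt_pow_right (by norm_num) hbm)⟩
  have hflip : Function.Involutive flip := fun f => Fin.ext (by simp [flip])
  have hneg : ∀ f, hadamardMat m (flip f) j * hadamardMat m (flip f) j'
      = -(hadamardMat m f j * hadamardMat m f j') := by
    intro f
    simp_rw [hadamardMat_eq_prod, div_mul_div_comm, ← Finset.prod_mul_distrib]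
    rw [← neg_div, ← Finset.mul_prod_erase _ _ (mem_range.2 hbm),
      ← Finset.mul_prod_erase _ _ (mem_range.2 hbm), ← neg_mul]
    congr 2
    · have hbit : (flip f).val.testBit b = !f.val.testBit b := by
        simp [flip, Nat.testBit_xor, Nat.testBit_two_pow_self]
      rw [hbit]
      revert hb
      cases j.val.testBit b <;> cases j'.val.testBit b <;> cases f.val.testBit b <;> simp
    · refine prod_congr rfl fun c hc => ?_
      have hbit : (flip f).val.testBit c = f.val.testBit c := by
        simp [flip, Nat.testBit_xor, Nat.testBit_two_pow_of_ne (ne_of_mem_erase hc).symm]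
      rw [hbit]
  have hsum := Equiv.sum_comp hflip.toPerm fun f => hadamardMat m f j * hadamardMat m f j'
  simp only [Function.Involutive.coe_toPerm, hneg, Finset.sum_neg_distrib] at hsum
  linarith

lemma sum_hadamardMat_mul (m : ℕ) (j j' : Fin (2 ^ m)) :
    ∑ f, hadamardMat m f j * hadamardMat m f j' = if j = j' then 1 else 0 := by
  split_ifs with h
  · subst h
    simp [← pow_two, hadamardMat_sq]
  · exact sum_hadamardMat_mul_of_ne m h

/-- The Hadamard transform preserves inner products. -/
lemma sum_hadamard_transform_mul (m : ℕ) (u v : Fin (2 ^ m) → ℝ) :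
    ∑ f, (∑ j, hadamardMat m f j * u j) * (∑ j, hadamardMat m f j * v j) = ∑ j, u j * v j := by
  simp_rw [Finset.sum_mul_sum]
  rw [sum_comm]
  refine sum_congr rfl fun j _ => ?_
  rw [sum_comm]
  have : ∀ j', ∑ f, hadamardMat m f j * u j * (hadamardMat m f j' * v j')
      = u j * v j' * (if j = j' then 1 else 0) := by
    intro j'
    rw [← sum_hadamardMat_mul, Finset.mul_sum]
    exact sum_congr rfl fun f _ => by ring
  simp [this]

/-- A coordinate of `Φx` as a linear form in all entries of `P`. -/
lemma sum_fjltEntry_mul {m k : ℕ} (p : (Fin k × Fin (2 ^ m)) → ℝ) (s : Fin (2 ^ m) → ℝ)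
    (i : Fin k) (x : Fin (2 ^ m) → ℝ) :
    ∑ j, fjltEntry p s i j * x j
      = ∑ r : Fin k × Fin (2 ^ m),
          (if r.1 = i then ∑ j, hadamardMat m r.2 j * (s j * x j) else 0) * p r := by
  rw [Fintype.sum_prod_type, Finset.sum_eq_single i]
  · simp only [if_true, fjltEntry, Finset.sum_mul]
    rw [sum_comm]
    exact sum_congr rfl fun f _ => sum_congr rfl fun j _ => by ring
  · intro i' _ h
    simp [h]
  · simp

/-- The mixed second moment of rows `i` and `n` of `Φ`, conditionally on the signs `s`. -/
lemma integral_fjlt_rows_of_signs {m k : ℕ} {q : ℝ} (hq0 : 0 < q) (hq1 : q ≤ 1)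
    (s : Fin (2 ^ m) → ℝ) (hs : ∀ j, s j ^ 2 = 1) (i n : Fin k) (x y : Fin (2 ^ m) → ℝ) :
    ∫ p, (∑ j, fjltEntry p s i j * x j) ^ 2 * (∑ j, fjltEntry p s n j * y j) ^ 2
        ∂(Measure.pi fun _ => fjltEntryMeasure q)
      = (∑ j, x j ^ 2) * (∑ j, y j ^ 2)
        + if i = n then 2 * (∑ j, x j * y j) ^ 2 + (3 / q - 3) *
          ∑ f, (∑ j, hadamardMat m f j * x j * s j) ^ 2 * (∑ j, hadamardMat m f j * y j * s j) ^ 2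
          else 0 := by
  obtain ⟨g1, g2, g3, g4⟩ := integral_pow_gaussianReal q.toNNReal⁻¹
  have hinv : ((q.toNNReal⁻¹ : ℝ≥0) : ℝ) = q⁻¹ := by simp [hq0.le]
  have hmom := fun n => integral_pow_fjltEntryMeasure hq0 hq1 n
  have h4 : ∫ t, t ^ 4 ∂(fjltEntryMeasure q) = 3 / q := by
    rw [hmom, g4, hinv]
    field_simp
    simp
  have hform : ∀ u : Fin (2 ^ m) → ℝ, ∀ f,
      ∑ j, hadamardMat m f j * u j * s j = ∑ j, hadamardMat m f j * (s j * u j) :=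
    fun u f => sum_congr rfl fun j _ => by ring
  have hinner : ∀ u v : Fin (2 ^ m) → ℝ, ∑ f, (∑ j, hadamardMat m f j * (s j * u j))
      * (∑ j, hadamardMat m f j * (s j * v j)) = ∑ j, u j * v j := by
    intro u v
    rw [sum_hadamard_transform_mul]
    refine sum_congr rfl fun j _ => ?_
    linear_combination u j * v j * hs j
  have hsq : ∀ u : Fin (2 ^ m) → ℝ,
      ∑ f, (∑ j, hadamardMat m f j * (s j * u j)) ^ 2 = ∑ j, u j ^ 2 := by
    intro u
    simpa only [pow_two] using hinner u u
  simp_rw [sum_fjltEntry_mul, hform]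
  rw [integral_sq_sum_mul_sq_sum (integrable_pow_fjltEntryMeasure q)
    (by rw [hmom]; simp) (by rw [hmom, g1]; simp) (by rw [hmom, g2, hinv]; field_simp; simp)
    (by rw [hmom, g3]; simp), h4]
  simp_rw [Fintype.sum_prod_type]
  simp only [ite_pow, ite_mul, mul_ite, zero_mul, mul_zero, ne_eq, OfNat.ofNat_ne_zero,
    not_false_eq_true, zero_pow, Finset.sum_ite_irrel, Finset.sum_const_zero, Finset.sum_ite_eq',
    mem_univ, if_true, hsq]
  by_cases hin : i = n
  · subst hin
    simp only [if_true, hinner]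
    ring
  · simp [hin, Ne.symm hin]

/-- The mixed second moment of a single coordinate of `HDx` and `HDy`. -/
lemma integral_hadamard_signs (m : ℕ) (f : Fin (2 ^ m)) (x y : Fin (2 ^ m) → ℝ) :
    ∫ s : Fin (2 ^ m) → ℝ, (∑ j, hadamardMat m f j * x j * s j) ^ 2
        * (∑ j, hadamardMat m f j * y j * s j) ^ 2 ∂(Measure.pi fun _ => signMeasure)
      = (1 / 2 ^ m) ^ 2 * ((∑ j, x j ^ 2) * (∑ j, y j ^ 2) + 2 * (∑ j, x j * y j) ^ 2
        - 2 * ∑ j, x j ^ 2 * y j ^ 2) := by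
  rw [integral_sq_sum_mul_sq_sum integrable_pow_signMeasure
    (by rw [integral_pow_signMeasure]; norm_num) (by rw [integral_pow_signMeasure]; norm_num)
    (by rw [integral_pow_signMeasure]; norm_num) (by rw [integral_pow_signMeasure]; norm_num),
    integral_pow_signMeasure]
  have hsq : ∀ u : Fin (2 ^ m) → ℝ,
      ∑ j, (hadamardMat m f j * u j) ^ 2 = 1 / 2 ^ m * ∑ j, u j ^ 2 := by
    intro u
    rw [Finset.mul_sum]
    exact sum_congr rfl fun j _ => by rw [mul_pow, hadamardMat_sq]
  have hinner : ∑ j, hadamardMat m f j * x j * (hadamardMat m f j * y j)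
      = 1 / 2 ^ m * ∑ j, x j * y j := by
    rw [Finset.mul_sum]
    refine sum_congr rfl fun j _ => ?_
    rw [← hadamardMat_sq m f j]
    ring
  have hfourth : ∑ j, (hadamardMat m f j * x j) ^ 2 * (hadamardMat m f j * y j) ^ 2
      = (1 / 2 ^ m) ^ 2 * ∑ j, x j ^ 2 * y j ^ 2 := by
    rw [Finset.mul_sum]
    refine sum_congr rfl fun j _ => ?_
    rw [← hadamardMat_sq m f j]
    ring
  rw [hsq, hsq, hinner, hfourth]
  ring

lemma measurable_sum_fjltEntry_mul {m k : ℕ} (i : Fin k) (x : Fin (2 ^ m) → ℝ) :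
    Measurable fun z : (Fin (2 ^ m) → ℝ) × ((Fin k × Fin (2 ^ m)) → ℝ) =>
      ∑ j, fjltEntry z.2 z.1 i j * x j := by
  unfold fjltEntry
  fun_prop

/-- The mixed second moment of rows `i` and `n` of `Φ`, for arbitrary `i` and `n`. -/
lemma integral_fjlt_rows
    {Ω : Type*} [MeasurableSpace Ω] {Pr : Measure Ω} [IsProbabilityMeasure Pr]
    {m k : ℕ} {q : ℝ} (hq0 : 0 < q) (hq1 : q ≤ 1)
    {P : Ω → (Fin k × Fin (2 ^ m)) → ℝ} (hPmeas : Measurable P)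
    (hPlaw : Measure.map P Pr = Measure.pi (fun _ => fjltEntryMeasure q))
    {D : Ω → Fin (2 ^ m) → ℝ} (hDmeas : Measurable D)
    (hDlaw : Measure.map D Pr = Measure.pi (fun _ => signMeasure))
    (hindep : IndepFun P D Pr) (i n : Fin k) (x y : Fin (2 ^ m) → ℝ) :
    ∫ ω, (∑ j, fjltEntry (P ω) (D ω) i j * x j) ^ 2
        * (∑ j, fjltEntry (P ω) (D ω) n j * y j) ^ 2 ∂Pr
      = (∑ j, x j ^ 2) * (∑ j, y j ^ 2)
        + if i = n then 2 * (∑ j, x j * y j) ^ 2 + (3 / q - 3) * (1 / 2 ^ m) *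
            ((∑ j, x j ^ 2) * (∑ j, y j ^ 2) + 2 * (∑ j, x j * y j) ^ 2
              - 2 * ∑ j, x j ^ 2 * y j ^ 2)
          else 0 := by
  set ν : Measure (Fin (2 ^ m) → ℝ) := Measure.pi fun _ => signMeasure
  set π : Measure ((Fin k × Fin (2 ^ m)) → ℝ) := Measure.pi fun _ => fjltEntryMeasure q
  have hνprob : IsProbabilityMeasure ν := by
    rw [← hDlaw]
    exact Measure.isProbabilityMeasure_map hDmeas.aemeasurable
  let F : (Fin (2 ^ m) → ℝ) × ((Fin k × Fin (2 ^ m)) → ℝ) → ℝ := fun z =>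
    (∑ j, fjltEntry z.2 z.1 i j * x j) ^ 2 * (∑ j, fjltEntry z.2 z.1 n j * y j) ^ 2
  have hF : Measurable F :=
    ((measurable_sum_fjltEntry_mul i x).pow_const 2).mul
      ((measurable_sum_fjltEntry_mul n y).pow_const 2)
  let V : Fin (2 ^ m) → (Fin (2 ^ m) → ℝ) → ℝ := fun f s =>
    (∑ j, hadamardMat m f j * x j * s j) ^ 2 * (∑ j, hadamardMat m f j * y j * s j) ^ 2
  have hV : ∀ f, Integrable (V f) ν := fun f =>
    integrable_sq_sum_mul_sq_sum integrable_pow_signMeasure _ _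
  let G : (Fin (2 ^ m) → ℝ) → ℝ := fun s => (∑ j, x j ^ 2) * (∑ j, y j ^ 2)
    + if i = n then 2 * (∑ j, x j * y j) ^ 2 + (3 / q - 3) * ∑ f, V f s else 0
  have hinner : ∀ᵐ s ∂ν, ∫ p, F (s, p) ∂π = G s := by
    have hsigns : ∀ᵐ s ∂ν, ∀ j, s j ^ 2 = 1 :=
      Filter.eventually_all.2 fun j =>
        (Measure.tendsto_eval_ae_ae (μ := fun _ : Fin (2 ^ m) => signMeasure)
          (i := j)).eventually ae_sq_eq_one_signMeasure
    filter_upwards [hsigns] with s hs using integral_fjlt_rows_of_signs hq0 hq1 s hs i n x y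
  have hsum : Integrable (fun s => ∑ f, V f s) ν := integrable_finsetSum _ fun f _ => hV f
  have hG : Integrable G ν := by
    refine (integrable_const _).add ?_
    split_ifs
    · exact (integrable_const _).add (hsum.const_mul _)
    · exact integrable_const _
  have hFint : Integrable F (ν.prod π) := by
    rw [integrable_prod_iff hF.aestronglyMeasurable]
    constructor
    · refine Filter.Eventually.of_forall fun s => ?_
      simp only [F, sum_fjltEntry_mul]
      exact integrable_sq_sum_mul_sq_sum (integrable_pow_fjltEntryMeasure q) _ _
    · refine hG.congr ?_
      filter_upwards [hinner] with s hs
      rw [← hs]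
      refine integral_congr_ae (Filter.Eventually.of_forall fun p => ?_)
      exact (Real.norm_of_nonneg (by positivity)).symm
  have hlaw : Measure.map (fun ω => (D ω, P ω)) Pr = ν.prod π := by
    rw [(indepFun_iff_map_prod_eq_prod_map_map hDmeas.aemeasurable hPmeas.aemeasurable).1
      hindep.symm, hDlaw, hPlaw]
  calc ∫ ω, F (D ω, P ω) ∂Pr = ∫ z, F z ∂(ν.prod π) := by
        rw [← hlaw, integral_map (hDmeas.prodMk hPmeas).aemeasurable hF.aestronglyMeasurable]
    _ = ∫ s, G s ∂ν := by rw [integral_prod _ hFint, integral_congr_ae hinner]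
    _ = _ := by
        have hVval : ∫ s, ∑ f, V f s ∂ν = 1 / 2 ^ m * ((∑ j, x j ^ 2) * (∑ j, y j ^ 2)
            + 2 * (∑ j, x j * y j) ^ 2 - 2 * ∑ j, x j ^ 2 * y j ^ 2) := by
          rw [integral_finsetSum _ fun f _ => hV f,
            sum_congr rfl fun f _ => integral_hadamard_signs m f x y]
          simp
          field_simp
        by_cases hin : i = n
        · simp only [G, hin, if_true]
          rw [integral_add (integrable_const _) ((integrable_const _).fun_add (hsum.const_mul _)),
            integral_add (integrable_const _) (hsum.const_mul _), integral_const_mul (3 / q - 3), hVval]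
          simp
          ring
        · simp [G, hin]

/-- For the FJLT `Φ` (`d = 2^m`) and fixed `x, y ∈ ℝ^d`: for every row
`i`, `E[(Φx)_i²·(Φy)_i²] = (3/d)·(d/3 + (1/q − 1))·(‖x‖₂²‖y‖₂² + 2⟨x,y⟩²)
− (6/d)·(1/q − 1)·Σ_j x_j² y_j²`, and for distinct rows `i ≠ n`,
`E[(Φx)_i²·(Φy)_n²] = ‖x‖₂²·‖y‖₂²`. -/
theorem fjlt_row_second_moments
    {Ω : Type*} [MeasurableSpace Ω] (Pr : Measure Ω) [IsProbabilityMeasure Pr]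
    (m k : ℕ) (hk : 0 < k) (q : ℝ) (hq0 : 0 < q) (hq1 : q ≤ 1)
    (P : Ω → (Fin k × Fin (2 ^ m)) → ℝ) (hPmeas : Measurable P)
    (hPlaw : Measure.map P Pr = Measure.pi (fun _ => fjltEntryMeasure q))
    (D : Ω → Fin (2 ^ m) → ℝ) (hDmeas : Measurable D)
    (hDlaw : Measure.map D Pr = Measure.pi (fun _ => signMeasure))
    (hindep : IndepFun P D Pr)
    (x y : Fin (2 ^ m) → ℝ) :
    (∀ i : Fin k,
      (∫ ω, (∑ j, fjltEntry (P ω) (D ω) i j * x j) ^ 2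
          * (∑ j, fjltEntry (P ω) (D ω) i j * y j) ^ 2 ∂Pr)
        = (3 / (2 ^ m : ℝ)) * ((2 ^ m : ℝ) / 3 + (1 / q - 1))
            * ((∑ j, (x j) ^ 2) * (∑ j, (y j) ^ 2) + 2 * (∑ j, x j * y j) ^ 2)
          - (6 / (2 ^ m : ℝ)) * (1 / q - 1) * (∑ j, (x j) ^ 2 * (y j) ^ 2))
    ∧ (∀ i n : Fin k, i ≠ n →
      (∫ ω, (∑ j, fjltEntry (P ω) (D ω) i j * x j) ^ 2
          * (∑ j, fjltEntry (P ω) (D ω) n j * y j) ^ 2 ∂Pr)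
        = (∑ j, (x j) ^ 2) * (∑ j, (y j) ^ 2)) := by
  constructor
  · intro i
    rw [integral_fjlt_rows hq0 hq1 hPmeas hPlaw hDmeas hDlaw hindep, if_pos rfl]
    field_simp
    ring
  · intro i n hin
    rw [integral_fjlt_rows hq0 hq1 hPmeas hPlaw hDmeas hDlaw hindep, if_neg hin, add_zero]
end

section
/- Let Φ be the FJLT as in the context, let x, y ∈ ℝ^d be fixed, let σ > 0, and let η, μ ∈ ℝ^d have their 2d coordinates i.i.d. distributed as N(0,σ²), independently of Φ. Then the input-perturbed estimator Ê := (1/k)·‖Φ(x+η) − Φ(y+μ)‖₂² − 2d·σ² is an unbiased estimator of the squared Euclidean distance: E[Ê] = ‖x−y‖₂². -/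
open MeasureTheory ProbabilityTheory Finset
open scoped ENNReal NNReal

instance : IsProbabilityMeasure signMeasure := by
  refine ⟨?_⟩
  have h : ((2 : ℝ≥0)⁻¹ : ℝ≥0) + 2⁻¹ = 1 := by
    rw [← NNReal.coe_inj]; push_cast; norm_num
  simp only [signMeasure, Measure.add_apply, Measure.smul_apply, measure_univ]
  rw [← add_smul, h, one_smul]

lemma isProbabilityMeasure_fjltEntryMeasure {q : ℝ} (hq0 : 0 ≤ q) (hq1 : q ≤ 1) :
    IsProbabilityMeasure (fjltEntryMeasure q) := by
  refine ⟨?_⟩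
  simp only [fjltEntryMeasure, Measure.add_apply, Measure.smul_apply, measure_univ]
  rw [← add_smul, ← Real.toNNReal_add hq0 (by linarith), add_sub_cancel, Real.toNNReal_one,
    one_smul]

lemma integrable_sq_gaussianReal_zero (v : ℝ≥0) :
    Integrable (fun x : ℝ => x ^ 2) (gaussianReal 0 v) :=
  (memLp_id_gaussianReal (μ := 0) (v := v) 2).integrable_sq

lemma integrable_id_gaussianReal_zero (v : ℝ≥0) :
    Integrable (fun x : ℝ => x) (gaussianReal 0 v) :=
  memLp_one_iff_integrable.1 (memLp_id_gaussianReal (μ := 0) (v := v) 1)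

lemma integral_sq_gaussianReal_zero (v : ℝ≥0) :
    ∫ x, x ^ 2 ∂gaussianReal 0 v = v := by
  have h := variance_eq_sub (memLp_id_gaussianReal (μ := 0) (v := v) 2)
  rw [variance_id_gaussianReal] at h
  simpa [integral_id_gaussianReal] using h.symm

lemma integrable_signMeasure (f : ℝ → ℝ) : Integrable f signMeasure :=
  (integrable_dirac (by simp)).smul_measure_nnreal.add_measure
    (integrable_dirac (by simp)).smul_measure_nnreal

lemma integral_signMeasure (f : ℝ → ℝ) :
    ∫ x, f x ∂signMeasure = (f (-1) + f 1) / 2 := by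
  rw [signMeasure, integral_add_measure (integrable_dirac (by simp)).smul_measure_nnreal
    (integrable_dirac (by simp)).smul_measure_nnreal]
  simp only [integral_smul_nnreal_measure, integral_dirac, NNReal.smul_def, smul_eq_mul]
  push_cast
  ring

lemma integrable_fjltEntryMeasure {q : ℝ} {f : ℝ → ℝ}
    (hf : Integrable f (gaussianReal 0 q.toNNReal⁻¹)) :
    Integrable f (fjltEntryMeasure q) :=
  hf.smul_measure_nnreal.add_measure (integrable_dirac (by simp)).smul_measure_nnreal

lemma integral_fjltEntryMeasure {q : ℝ} {f : ℝ → ℝ}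
    (hf : Integrable f (gaussianReal 0 q.toNNReal⁻¹)) :
    ∫ x, f x ∂fjltEntryMeasure q =
      q.toNNReal * ∫ x, f x ∂gaussianReal 0 q.toNNReal⁻¹ + (1 - q).toNNReal * f 0 := by
  rw [fjltEntryMeasure, integral_add_measure hf.smul_measure_nnreal
    (integrable_dirac (by simp)).smul_measure_nnreal]
  simp [integral_smul_nnreal_measure, NNReal.smul_def]

section Coordinates

variable {Ω ι : Type*} [MeasurableSpace Ω] {Pr : Measure Ω} [Fintype ι]
  {ν : Measure ℝ} [IsProbabilityMeasure ν] {Z : Ω → ι → ℝ}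

lemma map_coord_of_map_eq_pi (hZ : Measurable Z)
    (hlaw : Measure.map Z Pr = Measure.pi (fun _ => ν)) (a : ι) :
    Measure.map (fun ω => Z ω a) Pr = ν := by
  rw [← (measurePreserving_eval (fun _ : ι => ν) a).map_eq, ← hlaw,
    Measure.map_map (measurable_pi_apply a) hZ]
  rfl

lemma integral_coord_of_map_eq_pi (hZ : Measurable Z)
    (hlaw : Measure.map Z Pr = Measure.pi (fun _ => ν)) (a : ι) {f : ℝ → ℝ}
    (hf : Measurable f) :
    ∫ ω, f (Z ω a) ∂Pr = ∫ x, f x ∂ν := by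
  rw [← map_coord_of_map_eq_pi hZ hlaw a, integral_map (by fun_prop) (by fun_prop)]

lemma memLp_two_coord_of_map_eq_pi (hZ : Measurable Z)
    (hlaw : Measure.map Z Pr = Measure.pi (fun _ => ν))
    (hν : Integrable (fun x => x ^ 2) ν) (a : ι) :
    MemLp (fun ω => Z ω a) 2 Pr := by
  rw [memLp_two_iff_integrable_sq (by fun_prop)]
  rw [← map_coord_of_map_eq_pi hZ hlaw a] at hν
  exact hν.comp_measurable (by fun_prop)

lemma integral_coord_mul_coord_of_map_eq_pi [DecidableEq ι] [IsProbabilityMeasure Pr]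
    (hZ : Measurable Z) (hlaw : Measure.map Z Pr = Measure.pi (fun _ => ν))
    (hν0 : ∫ x, x ∂ν = 0) (a b : ι) :
    ∫ ω, Z ω a * Z ω b ∂Pr = if a = b then ∫ x, x ^ 2 ∂ν else 0 := by
  split_ifs with hab
  · subst hab
    simp_rw [← sq]
    exact integral_coord_of_map_eq_pi hZ hlaw a (f := fun x => x ^ 2) (by fun_prop)
  · have hind : iIndepFun (fun i ω => Z ω i) Pr := by
      rw [iIndepFun_iff_map_fun_eq_pi_map (fun i => by fun_prop)]
      simp_rw [map_coord_of_map_eq_pi hZ hlaw]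
      exact hlaw
    rw [(hind.indepFun hab).integral_fun_mul_eq_mul_integral (by fun_prop) (by fun_prop),
      integral_coord_of_map_eq_pi hZ hlaw a (f := fun x => x) measurable_id, hν0, zero_mul]

end Coordinates

lemma integral_const_add_sub_sq {Ω : Type*} [MeasurableSpace Ω] {Pr : Measure Ω}
    [IsProbabilityMeasure Pr] {U V : Ω → ℝ} (hU : MemLp U 2 Pr) (hV : MemLp V 2 Pr)
    (hU0 : ∫ ω, U ω ∂Pr = 0) (hV0 : ∫ ω, V ω ∂Pr = 0) (hUV : ∫ ω, U ω * V ω ∂Pr = 0) (c : ℝ) :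
    ∫ ω, (c + (U ω - V ω)) ^ 2 ∂Pr = c ^ 2 + (∫ ω, U ω ^ 2 ∂Pr + ∫ ω, V ω ^ 2 ∂Pr) := by
  have iU : Integrable U Pr := hU.integrable (by norm_num)
  have iV : Integrable V Pr := hV.integrable (by norm_num)
  have iUV : Integrable (fun ω => U ω * V ω) Pr := hU.integrable_mul hV
  have hc : Integrable (fun ω => 2 * c * (U ω - V ω)) Pr := (iU.sub iV).const_mul _
  have i₁ : Integrable (fun ω => c ^ 2 + 2 * c * (U ω - V ω)) Pr :=
    (integrable_const _).add hc
  have i₂ : Integrable (fun ω => U ω ^ 2 + V ω ^ 2) Pr := hU.integrable_sq.add hV.integrable_sq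
  have i₃ : Integrable (fun ω => c ^ 2 + 2 * c * (U ω - V ω) + (U ω ^ 2 + V ω ^ 2)) Pr :=
    i₁.add i₂
  have expand (ω : Ω) : (c + (U ω - V ω)) ^ 2 =
      (c ^ 2 + 2 * c * (U ω - V ω)) + (U ω ^ 2 + V ω ^ 2) - 2 * (U ω * V ω) := by ring
  simp_rw [expand]
  rw [integral_sub i₃ (iUV.const_mul 2), integral_add i₁ i₂,
    integral_add (integrable_const _) hc, integral_const_mul,
    integral_sub iU iV, integral_add hU.integrable_sq hV.integrable_sq, integral_const_mul,
    hU0, hV0, hUV]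
  simp

lemma sum_fjltEntry_mul_sq {m k : ℕ} (P : (Fin k × Fin (2 ^ m)) → ℝ) (D z : Fin (2 ^ m) → ℝ)
    (i : Fin k) :
    (∑ j, fjltEntry P D i j * z j) ^ 2 =
      ∑ j, ∑ j', ∑ f, ∑ f', hadamardMat m f j * hadamardMat m f' j' *
        ((P (i, f) * P (i, f')) * (D j * D j') * (z j * z j')) := by
  rw [sq, Finset.sum_mul_sum]
  refine Finset.sum_congr rfl fun j _ => Finset.sum_congr rfl fun j' _ => ?_
  rw [fjltEntry, fjltEntry, mul_mul_mul_comm, Finset.sum_mul_sum, Finset.sum_mul]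
  refine Finset.sum_congr rfl fun f _ => ?_
  rw [Finset.sum_mul]
  exact Finset.sum_congr rfl fun f' _ => by ring

section RowMoment

variable {Ω : Type*} [MeasurableSpace Ω] {Pr : Measure Ω} {m k : ℕ}
  {P : Ω → (Fin k × Fin (2 ^ m)) → ℝ} {D z : Ω → Fin (2 ^ m) → ℝ}

/-- The moments of the factors of a term in the expansion of a squared row of `Φ z`. -/
lemma integrable_and_integral_fjlt_term (hindepPD : IndepFun P D Pr)
    (hindepz : IndepFun (fun ω => (P ω, D ω)) z Pr)
    (hP : ∀ a, MemLp (fun ω => P ω a) 2 Pr) (hD : ∀ j, MemLp (fun ω => D ω j) 2 Pr)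
    (hz : ∀ j, MemLp (fun ω => z ω j) 2 Pr) (a b : Fin k × Fin (2 ^ m)) (j j' : Fin (2 ^ m)) :
    Integrable (fun ω => (P ω a * P ω b) * (D ω j * D ω j') * (z ω j * z ω j')) Pr ∧
    ∫ ω, (P ω a * P ω b) * (D ω j * D ω j') * (z ω j * z ω j') ∂Pr =
      (∫ ω, P ω a * P ω b ∂Pr) * (∫ ω, D ω j * D ω j' ∂Pr) * ∫ ω, z ω j * z ω j' ∂Pr := by
  have iP : Integrable (fun ω => P ω a * P ω b) Pr := (hP a).integrable_mul (hP b)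
  have iD : Integrable (fun ω => D ω j * D ω j') Pr := (hD j).integrable_mul (hD j')
  have iz : Integrable (fun ω => z ω j * z ω j') Pr := (hz j).integrable_mul (hz j')
  have indPD : IndepFun (fun ω => P ω a * P ω b) (fun ω => D ω j * D ω j') Pr :=
    hindepPD.comp (φ := fun p : Fin k × Fin (2 ^ m) → ℝ => p a * p b)
      (ψ := fun d : Fin (2 ^ m) → ℝ => d j * d j') (by fun_prop) (by fun_prop)
  have indz : IndepFun (fun ω => (P ω a * P ω b) * (D ω j * D ω j'))
      (fun ω => z ω j * z ω j') Pr :=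
    hindepz.comp (φ := fun p : (Fin k × Fin (2 ^ m) → ℝ) × (Fin (2 ^ m) → ℝ) =>
        (p.1 a * p.1 b) * (p.2 j * p.2 j')) (ψ := fun d : Fin (2 ^ m) → ℝ => d j * d j') (by fun_prop) (by fun_prop)
  have iPD : Integrable (fun ω => (P ω a * P ω b) * (D ω j * D ω j')) Pr :=
    indPD.integrable_mul iP iD
  refine ⟨indz.integrable_mul iPD iz, ?_⟩
  rw [indz.integral_fun_mul_eq_mul_integral iPD.aestronglyMeasurable iz.aestronglyMeasurable,
    indPD.integral_fun_mul_eq_mul_integral iP.aestronglyMeasurable iD.aestronglyMeasurable]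

/-- If the entries of `P` and of `D` are orthonormal in `L²`, then each row of `Φ z` has second
moment `E‖z‖²`, for `z` independent of `Φ`. -/
lemma integrable_and_integral_fjlt_row_sq (hindepPD : IndepFun P D Pr)
    (hindepz : IndepFun (fun ω => (P ω, D ω)) z Pr)
    (hP : ∀ a, MemLp (fun ω => P ω a) 2 Pr) (hD : ∀ j, MemLp (fun ω => D ω j) 2 Pr)
    (hz : ∀ j, MemLp (fun ω => z ω j) 2 Pr)
    (hPP : ∀ a b, ∫ ω, P ω a * P ω b ∂Pr = if a = b then 1 else 0)
    (hDD : ∀ j j', ∫ ω, D ω j * D ω j' ∂Pr = if j = j' then 1 else 0) (i : Fin k) :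
    Integrable (fun ω => (∑ j, fjltEntry (P ω) (D ω) i j * z ω j) ^ 2) Pr ∧
    ∫ ω, (∑ j, fjltEntry (P ω) (D ω) i j * z ω j) ^ 2 ∂Pr = ∑ j, ∫ ω, z ω j ^ 2 ∂Pr := by
  have term := integrable_and_integral_fjlt_term hindepPD hindepz hP hD hz
  simp_rw [sum_fjltEntry_mul_sq]
  have hterm (j j' f f' : Fin (2 ^ m)) : Integrable (fun ω =>
      hadamardMat m f j * hadamardMat m f' j' * ((P ω (i, f) * P ω (i, f')) *
        (D ω j * D ω j') * (z ω j * z ω j'))) Pr :=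
    (term (i, f) (i, f') j j').1.const_mul _
  have hterm₁ (j j' f : Fin (2 ^ m)) := integrable_finsetSum univ fun f' _ => hterm j j' f f'
  have hterm₂ (j j' : Fin (2 ^ m)) := integrable_finsetSum univ fun f _ => hterm₁ j j' f
  have hterm₃ (j : Fin (2 ^ m)) := integrable_finsetSum univ fun j' _ => hterm₂ j j'
  refine ⟨integrable_finsetSum univ fun j _ => hterm₃ j, ?_⟩
  rw [integral_finsetSum _ fun j _ => hterm₃ j]
  refine Finset.sum_congr rfl fun j _ => ?_
  rw [integral_finsetSum _ fun j' _ => hterm₂ j j']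
  simp_rw [integral_finsetSum _ fun f _ => hterm₁ j _ f,
    integral_finsetSum _ fun f' _ => hterm j _ _ f', integral_const_mul,
    (term _ _ _ _).2, hPP, hDD]
  simp [← sq, hadamardMat_sq]

end RowMoment

/-- For the FJLT `Φ` (`d = 2^m`), fixed `x, y ∈ ℝ^d`, `σ > 0`, and noise
`η = N ∘ Sum.inl`, `μ = N ∘ Sum.inr` whose `2d` coordinates are i.i.d. `N(0,σ²)`,
independent of `Φ`, the input-perturbed estimator
`Ê = (1/k)·‖Φ(x+η) − Φ(y+μ)‖₂² − 2dσ²` is unbiased: `E[Ê] = ‖x−y‖₂²`. -/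
theorem fjlt_input_perturbed_unbiased
    {Ω : Type*} [MeasurableSpace Ω] (Pr : Measure Ω) [IsProbabilityMeasure Pr]
    (m k : ℕ) (hk : 0 < k) (q : ℝ) (hq0 : 0 < q) (hq1 : q ≤ 1)
    (P : Ω → (Fin k × Fin (2 ^ m)) → ℝ) (hPmeas : Measurable P)
    (hPlaw : Measure.map P Pr = Measure.pi (fun _ => fjltEntryMeasure q))
    (D : Ω → Fin (2 ^ m) → ℝ) (hDmeas : Measurable D)
    (hDlaw : Measure.map D Pr = Measure.pi (fun _ => signMeasure))
    (hindepPD : IndepFun P D Pr)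
    (σ : ℝ) (hσ : 0 < σ)
    (N : Ω → (Fin (2 ^ m) ⊕ Fin (2 ^ m)) → ℝ) (hNmeas : Measurable N)
    (hNlaw : Measure.map N Pr = Measure.pi (fun _ => gaussianReal 0 (σ ^ 2).toNNReal))
    (hindepN : IndepFun (fun ω => (P ω, D ω)) N Pr)
    (x y : Fin (2 ^ m) → ℝ) :
    (∫ ω, (1 / (k : ℝ)) * (∑ i : Fin k,
        ((∑ j, fjltEntry (P ω) (D ω) i j * (x j + N ω (Sum.inl j)))
          - (∑ j, fjltEntry (P ω) (D ω) i j * (y j + N ω (Sum.inr j)))) ^ 2)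
        - 2 * (2 ^ m : ℝ) * σ ^ 2 ∂Pr)
      = ∑ j, (x j - y j) ^ 2 := by
  have := isProbabilityMeasure_fjltEntryMeasure hq0.le hq1
  have hv : ((σ ^ 2).toNNReal : ℝ) = σ ^ 2 := Real.coe_toNNReal _ (by positivity)
  have hP2 := memLp_two_coord_of_map_eq_pi hPmeas hPlaw
    (integrable_fjltEntryMeasure (integrable_sq_gaussianReal_zero _))
  have hD2 := memLp_two_coord_of_map_eq_pi hDmeas hDlaw (integrable_signMeasure _)
  have hN2 := memLp_two_coord_of_map_eq_pi hNmeas hNlaw (integrable_sq_gaussianReal_zero _)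
  have hPP (a b : Fin k × Fin (2 ^ m)) :
      ∫ ω, P ω a * P ω b ∂Pr = if a = b then 1 else 0 := by
    have hmean : ∫ x, x ∂fjltEntryMeasure q = 0 := by
      rw [integral_fjltEntryMeasure (integrable_id_gaussianReal_zero _),
        integral_id_gaussianReal]
      simp
    have hsq : ∫ x, x ^ 2 ∂fjltEntryMeasure q = 1 := by
      rw [integral_fjltEntryMeasure (integrable_sq_gaussianReal_zero _),
        integral_sq_gaussianReal_zero, NNReal.coe_inv, Real.coe_toNNReal _ hq0.le]
      simp [hq0.ne']
    rw [integral_coord_mul_coord_of_map_eq_pi hPmeas hPlaw hmean, hsq]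
  have hDD (j j' : Fin (2 ^ m)) : ∫ ω, D ω j * D ω j' ∂Pr = if j = j' then 1 else 0 := by
    rw [integral_coord_mul_coord_of_map_eq_pi hDmeas hDlaw (by simp [integral_signMeasure]),
      integral_signMeasure]
    norm_num
  have hN1 (a : Fin (2 ^ m) ⊕ Fin (2 ^ m)) : ∫ ω, N ω a ∂Pr = 0 := by
    rw [integral_coord_of_map_eq_pi hNmeas hNlaw a (f := fun x => x) measurable_id,
      integral_id_gaussianReal]
  have hNN (a b : Fin (2 ^ m) ⊕ Fin (2 ^ m)) :
      ∫ ω, N ω a * N ω b ∂Pr = if a = b then σ ^ 2 else 0 := by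
    rw [integral_coord_mul_coord_of_map_eq_pi hNmeas hNlaw integral_id_gaussianReal,
      integral_sq_gaussianReal_zero, hv]
  let z : Ω → Fin (2 ^ m) → ℝ := fun ω j => (x j - y j) + (N ω (Sum.inl j) - N ω (Sum.inr j))
  have hz2 (j : Fin (2 ^ m)) : MemLp (fun ω => z ω j) 2 Pr :=
    (memLp_const (x j - y j)).add ((hN2 (Sum.inl j)).sub (hN2 (Sum.inr j)))
  have hzsq (j : Fin (2 ^ m)) : ∫ ω, z ω j ^ 2 ∂Pr = (x j - y j) ^ 2 + 2 * σ ^ 2 := by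
    rw [integral_const_add_sub_sq (hN2 _) (hN2 _) (hN1 _) (hN1 _) (by simp [hNN]) (x j - y j)]
    simp_rw [sq (N _ _), hNN]
    simp only [if_true]
    ring
  have hindepz : IndepFun (fun ω => (P ω, D ω)) z Pr :=
    hindepN.comp (φ := id) (ψ := fun (n : Fin (2 ^ m) ⊕ Fin (2 ^ m) → ℝ) (j : Fin (2 ^ m)) =>
      (x j - y j) + (n (Sum.inl j) - n (Sum.inr j))) measurable_id (by fun_prop)
  have row := integrable_and_integral_fjlt_row_sq hindepPD hindepz hP2 hD2 hz2 hPP hDD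
  have hdiff (ω : Ω) (i : Fin k) :
      (∑ j, fjltEntry (P ω) (D ω) i j * (x j + N ω (Sum.inl j)))
        - (∑ j, fjltEntry (P ω) (D ω) i j * (y j + N ω (Sum.inr j)))
      = ∑ j, fjltEntry (P ω) (D ω) i j * z ω j := by
    rw [← Finset.sum_sub_distrib]
    exact Finset.sum_congr rfl fun j _ => by simp only [z]; ring
  simp_rw [hdiff]
  rw [integral_sub ((integrable_finsetSum _ fun i _ => (row i).1).const_mul _)
      (integrable_const _), integral_const_mul, integral_finsetSum _ fun i _ => (row i).1]
  simp_rw [fun i => (row i).2, hzsq]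
  have hk' : (k : ℝ) ≠ 0 := by positivity
  simp [Finset.sum_add_distrib]
  field_simp
  ring
end

section
/- Let S be the SJLT as in the context. Then for every fixed x ∈ ℝ^d, Var[‖Sx‖₂²] = (2/k)·(‖x‖₂⁴ − ‖x‖₄⁴), where ‖x‖₄⁴ = Σ_{j=1}^d x_j⁴; consequently, for all x, y ∈ ℝ^d, Var[‖Sx − Sy‖₂²] ≤ (2/k)·‖x−y‖₂⁴. -/
open MeasureTheory ProbabilityTheory Finset
open scoped ENNReal NNReal

/-- Law of a single pair `(h_r(j), φ_r(j))`: `h_r(j)` uniform on `Fin c`, independently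
`φ_r(j)` uniform on `{-1, +1}`. -/
noncomputable def hashSignMeasure (c : ℕ) [NeZero c] : Measure (Fin c × ℝ) :=
  ((PMF.uniformOfFintype (Fin c)).toMeasure).prod signMeasure

/-- The `((i,r), j)` entry of the SJLT matrix given the realization `G` of all
hash/sign pairs: `S_{(i,r),j} = s^{-1/2} · φ_r(j) · 1[h_r(j) = i]`, where
`h_r(j) = (G (r,j)).1` and `φ_r(j) = (G (r,j)).2`. -/
noncomputable def sjltEntry {s c d : ℕ} (G : (Fin s × Fin d) → Fin c × ℝ)
    (i : Fin c) (r : Fin s) (j : Fin d) : ℝ :=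
  (Real.sqrt s)⁻¹ * (G (r, j)).2 * (if (G (r, j)).1 = i then 1 else 0)


/-- The signed collision indicator of two hash/sign pairs:
`φ(p)·φ(q)·1[h(p) = h(q)]`. -/
noncomputable def signedCollision {ι : Type*} {c : ℕ} (p q : ι) (g : ι → Fin c × ℝ) : ℝ :=
  (g p).2 * (g q).2 * (if (g p).1 = (g q).1 then 1 else 0)

instance inst_s16 : IsProbabilityMeasure signMeasure := by
  constructor
  simp only [signMeasure, Measure.add_apply, Measure.smul_apply, measure_univ]
  simp [ENNReal.smul_def, ENNReal.inv_two_add_inv_two]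

instance (c : ℕ) [NeZero c] : IsProbabilityMeasure (hashSignMeasure c) := by
  unfold hashSignMeasure; infer_instance

lemma measurePreserving_neg_signMeasure :
    MeasurePreserving (fun a : ℝ => -a) signMeasure signMeasure := by
  refine ⟨measurable_neg, ?_⟩
  rw [signMeasure, Measure.map_add _ _ measurable_neg, Measure.map_smul, Measure.map_smul,
    Measure.map_dirac' measurable_neg, Measure.map_dirac' measurable_neg, neg_neg, add_comm]

lemma ae_signMeasure_sq_eq_one : ∀ᵐ a ∂signMeasure, a ^ 2 = 1 := by
  simp [signMeasure, ae_add_measure_iff]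

lemma ae_hashSignMeasure_sq_eq_one (c : ℕ) [NeZero c] :
    ∀ᵐ z ∂hashSignMeasure c, z.2 ^ 2 = 1 :=
  Measure.quasiMeasurePreserving_snd.ae ae_signMeasure_sq_eq_one

lemma integral_hashSignMeasure_sq_mul_indicator (c : ℕ) [NeZero c] (i : Fin c) :
    ∫ z, z.2 ^ 2 * (if z.1 = i then (1 : ℝ) else 0) ∂hashSignMeasure c = (c : ℝ)⁻¹ := by
  have h1 : ∫ a, a ^ 2 ∂signMeasure = 1 := by
    rw [integral_congr_ae (g := fun _ => (1 : ℝ)) ae_signMeasure_sq_eq_one]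
    simp
  simp_rw [mul_comm (_ ^ 2)]
  rw [hashSignMeasure, integral_prod_mul (fun a : Fin c => if a = i then (1 : ℝ) else 0)
    (fun a : ℝ => a ^ 2), h1, PMF.integral_eq_sum]
  simp

lemma signedCollision_comm {ι : Type*} {c : ℕ} (p q : ι) (g : ι → Fin c × ℝ) :
    signedCollision p q g = signedCollision q p g := by
  simp only [signedCollision, eq_comm (a := (g p).1)]
  ring

@[fun_prop]
lemma measurable_signedCollision {ι : Type*} {c : ℕ} (p q : ι) :
    Measurable (signedCollision (c := c) p q) := by
  unfold signedCollision
  refine Measurable.mul (by fun_prop) (Measurable.ite ?_ (by fun_prop) (by fun_prop))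
  exact measurableSet_eq_fun (by fun_prop) (by fun_prop)

section Pi

variable {ι : Type*} [Fintype ι] {c : ℕ} [NeZero c]

lemma ae_pi_hashSignMeasure_sq_eq_one :
    ∀ᵐ g ∂Measure.pi (fun _ : ι => hashSignMeasure c), ∀ p, (g p).2 ^ 2 = 1 :=
  Filter.eventually_all.2 fun p =>
    (Measure.quasiMeasurePreserving_eval (fun _ : ι => hashSignMeasure c) p).ae
      (ae_hashSignMeasure_sq_eq_one c)

lemma ae_abs_signedCollision_le_one :
    ∀ᵐ g ∂Measure.pi (fun _ : ι => hashSignMeasure c),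
      ∀ p q, |signedCollision p q g| ≤ 1 := by
  filter_upwards [ae_pi_hashSignMeasure_sq_eq_one] with g hg p q
  have habs : ∀ p, |(g p).2| = 1 := fun p => by
    rw [← sq_eq_sq₀ (abs_nonneg _) zero_le_one, sq_abs, hg, one_pow]
  unfold signedCollision
  split_ifs <;> simp [abs_mul, habs]

lemma integrable_signedCollision (p q : ι) :
    Integrable (signedCollision p q) (Measure.pi (fun _ : ι => hashSignMeasure c)) := by
  refine Integrable.of_bound (by fun_prop) 1 ?_
  filter_upwards [ae_abs_signedCollision_le_one] with g hg using hg p q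

lemma integrable_signedCollision_mul (p q p' q' : ι) :
    Integrable (fun g => signedCollision p q g * signedCollision p' q' g)
      (Measure.pi (fun _ : ι => hashSignMeasure c)) := by
  refine Integrable.of_bound (by fun_prop) 1 ?_
  filter_upwards [ae_abs_signedCollision_le_one] with g hg
  rw [Real.norm_eq_abs, abs_mul]
  exact mul_le_one₀ (hg _ _) (abs_nonneg _) (hg _ _)

/-- A statistic of the hash/sign pairs that changes sign when the sign at `p` is flipped
has mean zero. -/
lemma integral_eq_zero_of_flip [DecidableEq ι] (p : ι) {f : (ι → Fin c × ℝ) → ℝ}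
    (hf : Measurable f)
    (hflip : ∀ g, f (Function.update g p ((g p).1, -(g p).2)) = -f g) :
    ∫ g, f g ∂Measure.pi (fun _ : ι => hashSignMeasure c) = 0 := by
  let F : ι → Fin c × ℝ → Fin c × ℝ := fun k => if k = p then Prod.map id (fun a => -a) else id
  have hF : ∀ k, MeasurePreserving (F k) (hashSignMeasure c) (hashSignMeasure c) := fun k => by
    by_cases hk : k = p
    · simp only [F, hk, if_true]
      exact (MeasurePreserving.id _).prod measurePreserving_neg_signMeasure
    · simp only [F, hk, if_false]
      exact MeasurePreserving.id _
  have hmp := measurePreserving_pi (fun _ : ι => hashSignMeasure c)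
    (fun _ : ι => hashSignMeasure c) hF
  have hFup : ∀ g : ι → Fin c × ℝ,
      (fun k => F k (g k)) = Function.update g p ((g p).1, -(g p).2) := fun g => by
    funext k
    by_cases hk : k = p
    · subst hk; simp [F, Prod.map]
    · simp [F, hk]
  have h := integral_map (μ := Measure.pi (fun _ : ι => hashSignMeasure c))
    hmp.measurable.aemeasurable (f := f) hf.aestronglyMeasurable
  rw [hmp.map_eq] at h
  simp only [hFup, hflip, integral_neg] at h
  linarith

lemma integral_signedCollision {p q : ι} (hpq : p ≠ q) :
    ∫ g, signedCollision p q g ∂Measure.pi (fun _ : ι => hashSignMeasure c) = 0 := by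
  classical
  refine integral_eq_zero_of_flip p (by fun_prop) fun g => ?_
  simp only [signedCollision, hpq.symm, ne_eq, not_false_eq_true, Function.update_self,
    Function.update_of_ne]
  ring

lemma integral_signedCollision_mul_of_notMem {p q p' q' : ι} (hpq : p ≠ q) (hp' : p ≠ p')
    (hq' : p ≠ q') :
    ∫ g, signedCollision p q g * signedCollision p' q' g
      ∂Measure.pi (fun _ : ι => hashSignMeasure c) = 0 := by
  classical
  refine integral_eq_zero_of_flip p (by fun_prop) fun g => ?_
  simp only [signedCollision, hpq.symm, hp'.symm, hq'.symm, ne_eq, not_false_eq_true, Function.update_self,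
    Function.update_of_ne]
  ring

lemma integral_signedCollision_sq {p q : ι} (hpq : p ≠ q) :
    ∫ g, signedCollision p q g * signedCollision p q g
      ∂Measure.pi (fun _ : ι => hashSignMeasure c) = (c : ℝ)⁻¹ := by
  let u : Fin c → Fin c × ℝ → ℝ := fun i z => z.2 ^ 2 * (if z.1 = i then 1 else 0)
  have hu : ∀ i, Measurable (u i) := fun i =>
    Measurable.mul (by fun_prop) (Measurable.ite
      (measurableSet_eq_fun (by fun_prop) (by fun_prop)) (by fun_prop) (by fun_prop))
  have hexp : ∀ g : ι → Fin c × ℝ,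
      signedCollision p q g * signedCollision p q g = ∑ i, u i (g p) * u i (g q) := fun g => by
    simp only [u, signedCollision]
    rw [Finset.sum_eq_single (g p).1]
    · simp only [if_true, eq_comm (a := (g q).1)]
      split_ifs <;> ring
    · intro i _ hi
      simp [hi.symm]
    · simp
  have hone : ∀ k i, ∫ g, u i (g k) ∂Measure.pi (fun _ : ι => hashSignMeasure c) = (c : ℝ)⁻¹ :=
    fun k i => by
      rw [← integral_hashSignMeasure_sq_mul_indicator c i]
      have hmp := measurePreserving_eval (fun _ : ι => hashSignMeasure c) k
      conv_rhs => rw [← hmp.map_eq]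
      rw [integral_map hmp.measurable.aemeasurable (hu i).aestronglyMeasurable]
  have hint : ∀ i, Integrable (fun g : ι → Fin c × ℝ => u i (g p) * u i (g q))
      (Measure.pi (fun _ : ι => hashSignMeasure c)) := fun i => by
    have := hu i
    refine Integrable.of_bound (by fun_prop) 1 ?_
    filter_upwards [ae_pi_hashSignMeasure_sq_eq_one] with g hg
    simp only [u, hg]
    split_ifs <;> simp
  simp_rw [hexp]
  rw [integral_finsetSum _ fun i _ => hint i]
  have hind : ∀ i, ∫ g, u i (g p) * u i (g q) ∂Measure.pi (fun _ : ι => hashSignMeasure c)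
      = (c : ℝ)⁻¹ * (c : ℝ)⁻¹ := fun i => by
    have h := (iIndepFun_pi (μ := fun _ : ι => hashSignMeasure c) (X := fun _ => u i)
      fun _ => (hu i).aemeasurable).indepFun hpq
    rw [h.integral_fun_mul_eq_mul_integral
      ((hu i).comp (measurable_pi_apply p)).aestronglyMeasurable
      ((hu i).comp (measurable_pi_apply q)).aestronglyMeasurable, hone, hone]
  simp [hind, NeZero.ne c]

end Pi

/-- Distinct unordered pairs have uncorrelated signed collisions. -/
lemma integral_signedCollision_mul_eq_zero {ι : Type*} [Fintype ι] {c : ℕ} [NeZero c]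
    {p q p' q' : ι} (hpq : p ≠ q) (h : ¬(p = p' ∧ q = q')) (h' : ¬(p = q' ∧ q = p')) :
    ∫ g, signedCollision p q g * signedCollision p' q' g
      ∂Measure.pi (fun _ : ι => hashSignMeasure c) = 0 := by
  by_cases hp : p ≠ p' ∧ p ≠ q'
  · exact integral_signedCollision_mul_of_notMem hpq hp.1 hp.2
  · simp_rw [signedCollision_comm p q]
    refine integral_signedCollision_mul_of_notMem hpq.symm ?_ ?_ <;> grind

lemma sum_sum_eq_sum_diag_add_two_mul {ι : Type*} [Fintype ι] [LinearOrder ι]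
    (f : ι → ι → ℝ) (hf : ∀ j l, f j l = f l j) :
    ∑ j, ∑ l, f j l = ∑ j, f j j + 2 * ∑ j, ∑ l, if j < l then f j l else 0 := by
  have hsplit : ∀ j l, f j l = (if j = l then f j l else 0) + (if j < l then f j l else 0)
      + (if l < j then f l j else 0) := fun j l => by
    rcases lt_trichotomy j l with h | h | h
    · simp [h, h.ne, h.not_gt]
    · simp [h]
    · simp [h, h.ne', h.not_gt, hf j l]
  calc ∑ j, ∑ l, f j l
      = ∑ j, ∑ l, ((if j = l then f j l else 0) + (if j < l then f j l else 0)
          + (if l < j then f l j else 0)) :=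
        Finset.sum_congr rfl fun j _ => Finset.sum_congr rfl fun l _ => hsplit j l
    _ = ∑ j, f j j + 2 * ∑ j, ∑ l, if j < l then f j l else 0 := by
        simp only [Finset.sum_add_distrib, Finset.sum_ite_eq, Finset.mem_univ, if_true]
        rw [Finset.sum_comm (f := fun j l => if l < j then f l j else 0)]
        ring

/-- The off-diagonal part of `‖Sx‖₂²`, up to the factor `2 / s`. -/
noncomputable def offDiagonalSum {s c d : ℕ} (x : Fin d → ℝ)
    (g : (Fin s × Fin d) → Fin c × ℝ) : ℝ :=
  ∑ t : Fin s × Fin d × Fin d, (if t.2.1 < t.2.2 then x t.2.1 * x t.2.2 else 0) *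
    signedCollision (t.1, t.2.1) (t.1, t.2.2) g

lemma sum_sjltEntry_mul_sjltEntry {s c d : ℕ} (g : (Fin s × Fin d) → Fin c × ℝ)
    (r : Fin s) (j l : Fin d) :
    ∑ i, sjltEntry g i r j * sjltEntry g i r l
      = (s : ℝ)⁻¹ * signedCollision (r, j) (r, l) g := by
  rw [Finset.sum_eq_single (g (r, j)).1]
  · have hs : (Real.sqrt s)⁻¹ * (Real.sqrt s)⁻¹ = (s : ℝ)⁻¹ := by
      rw [← mul_inv, Real.mul_self_sqrt (Nat.cast_nonneg s)]
    simp only [sjltEntry, signedCollision, if_true, ← hs, eq_comm (a := (g (r, l)).1)]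
    ring
  · intro i _ hi
    simp [sjltEntry, hi.symm]
  · simp

lemma sum_sjlt_sq_eq {s c d : ℕ} [NeZero s] (x : Fin d → ℝ)
    (g : (Fin s × Fin d) → Fin c × ℝ) (hg : ∀ p, (g p).2 ^ 2 = 1) :
    ∑ i : Fin c, ∑ r : Fin s, (∑ j, sjltEntry g i r j * x j) ^ 2
      = ∑ j, x j ^ 2 + (2 / s) * offDiagonalSum x g := by
  have hs : (s : ℝ) ≠ 0 := Nat.cast_ne_zero.2 (NeZero.ne s)
  have hr : ∀ r : Fin s, ∑ i : Fin c, (∑ j, sjltEntry g i r j * x j) ^ 2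
      = (s : ℝ)⁻¹ * ∑ j, x j ^ 2 + (2 / s) * ∑ j, ∑ l,
        (if j < l then x j * x l else 0) * signedCollision (r, j) (r, l) g := fun r => by
    calc ∑ i : Fin c, (∑ j, sjltEntry g i r j * x j) ^ 2
        = ∑ i : Fin c, ∑ j, ∑ l, x j * x l * (sjltEntry g i r j * sjltEntry g i r l) := by
          refine Finset.sum_congr rfl fun i _ => ?_
          rw [sq, Finset.sum_mul_sum]
          exact Finset.sum_congr rfl fun j _ => Finset.sum_congr rfl fun l _ => by ring
      _ = ∑ j, ∑ l, x j * x l * ((s : ℝ)⁻¹ * signedCollision (r, j) (r, l) g) := by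
          rw [Finset.sum_comm]
          refine Finset.sum_congr rfl fun j _ => ?_
          rw [Finset.sum_comm]
          refine Finset.sum_congr rfl fun l _ => ?_
          rw [← Finset.mul_sum, sum_sjltEntry_mul_sjltEntry]
      _ = _ := by
          rw [sum_sum_eq_sum_diag_add_two_mul _ fun j l => by
            rw [signedCollision_comm, mul_comm (x j)]]
          congr 1
          · rw [Finset.mul_sum]
            refine Finset.sum_congr rfl fun j _ => ?_
            simp only [signedCollision, if_true, ← sq, hg]
            ring
          · simp only [Finset.mul_sum]
            refine Finset.sum_congr rfl fun j _ => Finset.sum_congr rfl fun l _ => ?_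
            split_ifs <;> ring
  rw [Finset.sum_comm, Finset.sum_congr rfl fun r _ => hr r, Finset.sum_add_distrib,
    ← Finset.mul_sum, ← Finset.mul_sum, offDiagonalSum]
  simp only [Fintype.sum_prod_type, Finset.sum_const, Finset.card_univ, Fintype.card_fin,
    nsmul_eq_mul]
  rw [inv_mul_cancel_left₀ hs]

@[fun_prop]
lemma measurable_offDiagonalSum {s c d : ℕ} (x : Fin d → ℝ) :
    Measurable (offDiagonalSum (s := s) (c := c) x) := by
  unfold offDiagonalSum
  fun_prop

lemma integral_offDiagonalSum {s c d : ℕ} [NeZero c] (x : Fin d → ℝ) :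
    ∫ g, offDiagonalSum x g
      ∂Measure.pi (fun _ : Fin s × Fin d => hashSignMeasure c) = 0 := by
  simp only [offDiagonalSum]
  rw [integral_finsetSum _ fun t _ => (integrable_signedCollision _ _).const_mul _]
  refine Finset.sum_eq_zero fun t _ => ?_
  rw [integral_const_mul]
  by_cases h : t.2.1 < t.2.2
  · rw [integral_signedCollision (by simp [h.ne]), mul_zero]
  · simp [h]

lemma integral_offDiagonalSum_sq {s c d : ℕ} [NeZero c] (x : Fin d → ℝ) :
    ∫ g, offDiagonalSum x g ^ 2
      ∂Measure.pi (fun _ : Fin s × Fin d => hashSignMeasure c)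
      = s / c * ∑ j, ∑ l, if j < l then x j ^ 2 * x l ^ 2 else 0 := by
  let a : Fin s × Fin d × Fin d → ℝ := fun t => if t.2.1 < t.2.2 then x t.2.1 * x t.2.2 else 0
  let W : Fin s × Fin d × Fin d → (Fin s × Fin d → Fin c × ℝ) → ℝ :=
    fun t => signedCollision (t.1, t.2.1) (t.1, t.2.2)
  have hexp : ∀ g : Fin s × Fin d → Fin c × ℝ,
      offDiagonalSum x g ^ 2 = ∑ t, ∑ t', a t * a t' * (W t g * W t' g) := fun g => by
    rw [offDiagonalSum, sq, Finset.sum_mul_sum]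
    exact Finset.sum_congr rfl fun t _ => Finset.sum_congr rfl fun t' _ => by
      simp only [a, W]; ring
  have hint : ∀ t t', Integrable (fun g => a t * a t' * (W t g * W t' g))
      (Measure.pi (fun _ : Fin s × Fin d => hashSignMeasure c)) := fun t t' =>
    (integrable_signedCollision_mul _ _ _ _).const_mul _
  have hval : ∀ t t', ∫ g, a t * a t' * (W t g * W t' g)
      ∂Measure.pi (fun _ : Fin s × Fin d => hashSignMeasure c)
      = if t = t' then a t ^ 2 * (c : ℝ)⁻¹ else 0 := fun t t' => by
    rw [integral_const_mul]
    by_cases ht : t.2.1 < t.2.2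
    · by_cases ht' : t'.2.1 < t'.2.2
      · have hne : (t.1, t.2.1) ≠ (t.1, t.2.2) := by simp [ht.ne]
        split_ifs with heq
        · subst heq
          rw [integral_signedCollision_sq hne, sq]
        · obtain ⟨r, j, l⟩ := t
          obtain ⟨r', j', l'⟩ := t'
          simp only [W]
          rw [integral_signedCollision_mul_eq_zero hne, mul_zero]
          · rintro ⟨h1, h2⟩
            simp only [Prod.mk.injEq] at h1 h2
            exact heq (by simp [h1, h2])
          · rintro ⟨h1, h2⟩
            simp only [Prod.mk.injEq] at h1 h2
            simp only [h1.2, h2.2] at ht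
            exact ht.not_gt ht'
      · have : t ≠ t' := fun h => ht' (h ▸ ht)
        simp [a, ht', this]
    · simp [a, ht]
  simp_rw [hexp]
  rw [integral_finsetSum _ fun t _ => integrable_finsetSum _ fun t' _ => hint t t']
  simp_rw [integral_finsetSum _ fun t' _ => hint _ t', hval]
  simp only [Finset.sum_ite_eq, Finset.mem_univ, if_true, ← Finset.sum_mul, a,
    Fintype.sum_prod_type, Finset.sum_const, Finset.card_univ, Fintype.card_fin, nsmul_eq_mul,
    ite_pow, mul_pow, zero_pow two_ne_zero]
  ring

lemma measurable_sjltEntry {s c d : ℕ} (i : Fin c) (r : Fin s) (j : Fin d) :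
    Measurable fun g : (Fin s × Fin d) → Fin c × ℝ => sjltEntry g i r j := by
  unfold sjltEntry
  refine Measurable.mul (by fun_prop) (Measurable.ite ?_ (by fun_prop) (by fun_prop))
  exact measurableSet_eq_fun (by fun_prop) (by fun_prop)

lemma variance_sum_sjlt_sq {Ω : Type*} [MeasurableSpace Ω] (Pr : Measure Ω)
    (s c d : ℕ) [NeZero s] [NeZero c]
    (G : Ω → (Fin s × Fin d) → Fin c × ℝ) (hGmeas : Measurable G)
    (hGlaw : Measure.map G Pr = Measure.pi (fun _ => hashSignMeasure c)) (x : Fin d → ℝ) :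
    variance (fun ω =>
        ∑ i : Fin c, ∑ r : Fin s, (∑ j, sjltEntry (G ω) i r j * x j) ^ 2) Pr
      = (2 / ((c : ℝ) * (s : ℝ))) * ((∑ j, (x j) ^ 2) ^ 2 - ∑ j, (x j) ^ 4) := by
  have hs : (s : ℝ) ≠ 0 := Nat.cast_ne_zero.2 (NeZero.ne s)
  have hc : (c : ℝ) ≠ 0 := Nat.cast_ne_zero.2 (NeZero.ne c)
  have hmeas : Measurable fun g : (Fin s × Fin d) → Fin c × ℝ =>
      ∑ i : Fin c, ∑ r : Fin s, (∑ j, sjltEntry g i r j * x j) ^ 2 := by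
    have := measurable_sjltEntry (s := s) (c := c) (d := d)
    fun_prop
  have hpairs : (∑ j, x j ^ 2) ^ 2
      = ∑ j, x j ^ 4 + 2 * ∑ j, ∑ l, if j < l then x j ^ 2 * x l ^ 2 else 0 := by
    rw [sq, Finset.sum_mul_sum, sum_sum_eq_sum_diag_add_two_mul _ fun j l => mul_comm _ _]
    simp only [← pow_add]
  have hmap := variance_map (μ := Pr) (Y := G) hmeas.aemeasurable hGmeas.aemeasurable
  rw [Function.comp_def, hGlaw] at hmap
  rw [← hmap, variance_congr (ae_pi_hashSignMeasure_sq_eq_one.mono fun g hg =>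
      sum_sjlt_sq_eq x g hg),
    variance_const_add (by fun_prop), variance_const_mul,
    variance_of_integral_eq_zero (by fun_prop) (integral_offDiagonalSum x),
    integral_offDiagonalSum_sq, hpairs]
  field_simp
  ring

/-- For the SJLT `S` (with `k = c·s`), for every fixed `x ∈ ℝ^d`,
`Var[‖Sx‖₂²] = (2/k)·(‖x‖₂⁴ − ‖x‖₄⁴)`; consequently, for all `x, y ∈ ℝ^d`,
`Var[‖Sx − Sy‖₂²] ≤ (2/k)·‖x−y‖₂⁴`. -/
theorem sjlt_variance
    {Ω : Type*} [MeasurableSpace Ω] (Pr : Measure Ω) [IsProbabilityMeasure Pr]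
    (s c d : ℕ) [NeZero s] [NeZero c]
    (G : Ω → (Fin s × Fin d) → Fin c × ℝ) (hGmeas : Measurable G)
    (hGlaw : Measure.map G Pr = Measure.pi (fun _ => hashSignMeasure c)) :
    (∀ x : Fin d → ℝ,
      variance (fun ω =>
          ∑ i : Fin c, ∑ r : Fin s, (∑ j, sjltEntry (G ω) i r j * x j) ^ 2) Pr
        = (2 / ((c : ℝ) * (s : ℝ))) * ((∑ j, (x j) ^ 2) ^ 2 - ∑ j, (x j) ^ 4))
    ∧ (∀ x y : Fin d → ℝ,
      variance (fun ω =>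
          ∑ i : Fin c, ∑ r : Fin s,
            ((∑ j, sjltEntry (G ω) i r j * x j)
              - (∑ j, sjltEntry (G ω) i r j * y j)) ^ 2) Pr
        ≤ (2 / ((c : ℝ) * (s : ℝ))) * (∑ j, (x j - y j) ^ 2) ^ 2) := by
  refine ⟨variance_sum_sjlt_sq Pr s c d G hGmeas hGlaw, fun x y => ?_⟩
  simp_rw [← Finset.sum_sub_distrib, ← mul_sub]
  rw [variance_sum_sjlt_sq Pr s c d G hGmeas hGlaw fun j => x j - y j]
  gcongr
  exact sub_le_self _ (Finset.sum_nonneg fun j _ => by positivity)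
end
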